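/- arXiv:2111.05420 — 2 statements merged into one kernel-verified Lean document; each statement's English description precedes it below -/
import Mathlib

section
/- Let s ≥ 1 and t ≥ s + 2 be integers and let G be a graph with q ≥ 1 edges. Then the number of copies of K_{s,t} in G is at most (8e²q/(st))^t, where a copy of K_{s,t} is a pair (S, T) of disjoint vertex subsets of G with |S| = s and |T| = t such that every vertex of S is adjacent to every vertex of T. -/
open Finset

/-- The copies of `K_{s,t}` in `G`, as a type of pairs of vertex sets. -/
abbrev BicliqueCopy {V : Type*} (G : SimpleGraph V) (s t : ℕ) : Type _ :=
  {p : Finset V × Finset V | p.1.card = s ∧ p.2.card = t ∧ Disjoint p.1 p.2 ∧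
    ∀ a ∈ p.1, ∀ b ∈ p.2, G.Adj a b}

/-- The sequence of darts from `S` to `T` in a copy `(S, T)` of `K_{s,s+k}` given by an enumeration
of `T` and a surjection onto `S`, the latter being a bijection on the first `s` indices. -/
noncomputable def bicliqueDarts {V : Type*} (G : SimpleGraph V) (s k : ℕ)
    (x : BicliqueCopy G s (s + k) × Equiv.Perm (Fin (s + k)) × Equiv.Perm (Fin s) ×
      (Fin k → Fin s)) (i : Fin (s + k)) : G.Dart where
  fst := (x.1.1.1.equivFinOfCardEq x.1.2.1).symm (Fin.append x.2.2.1 x.2.2.2 i)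
  snd := (x.1.1.2.equivFinOfCardEq x.1.2.2.1).symm (x.2.1 i)
  adj := x.1.2.2.2.2 _ (Subtype.coe_prop _) _ (Subtype.coe_prop _)

theorem mem_fst_iff_exists_bicliqueDarts {V : Type*} (G : SimpleGraph V) (s k : ℕ)
    (x : BicliqueCopy G s (s + k) × Equiv.Perm (Fin (s + k)) × Equiv.Perm (Fin s) ×
      (Fin k → Fin s)) (v : V) :
    v ∈ x.1.1.1 ↔ ∃ i, (bicliqueDarts G s k x i).fst = v := by
  constructor
  · intro hv
    refine ⟨Fin.castAdd k (x.2.2.1.symm (x.1.1.1.equivFinOfCardEq x.1.2.1 ⟨v, hv⟩)), ?_⟩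
    simp [bicliqueDarts]
  · rintro ⟨i, rfl⟩
    exact Subtype.coe_prop _

theorem mem_snd_iff_exists_bicliqueDarts {V : Type*} (G : SimpleGraph V) (s k : ℕ)
    (x : BicliqueCopy G s (s + k) × Equiv.Perm (Fin (s + k)) × Equiv.Perm (Fin s) ×
      (Fin k → Fin s)) (v : V) :
    v ∈ x.1.1.2 ↔ ∃ i, (bicliqueDarts G s k x i).snd = v := by
  constructor
  · intro hv
    refine ⟨x.2.1.symm (x.1.1.2.equivFinOfCardEq x.1.2.2.1 ⟨v, hv⟩), ?_⟩
    simp [bicliqueDarts]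
  · rintro ⟨i, rfl⟩
    exact Subtype.coe_prop _

theorem bicliqueDarts_injective {V : Type*} (G : SimpleGraph V) (s k : ℕ) :
    Function.Injective (bicliqueDarts G s k) := by
  intro x y h
  have hcopy : x.1 = y.1 := by
    refine Subtype.ext (Prod.ext ?_ ?_)
    · ext v
      rw [mem_fst_iff_exists_bicliqueDarts, mem_fst_iff_exists_bicliqueDarts, h]
    · ext v
      rw [mem_snd_iff_exists_bicliqueDarts, mem_snd_iff_exists_bicliqueDarts, h]
  obtain ⟨c, σ, τ, g⟩ := x
  obtain ⟨c', σ', τ', g'⟩ := y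
  obtain rfl : c = c' := hcopy
  have happ (i) : Fin.append τ g i = Fin.append τ' g' i := by
    have := congrArg (fun d : G.Dart => d.fst) (congrFun h i)
    simpa only [bicliqueDarts, Subtype.coe_inj, EmbeddingLike.apply_eq_iff_eq] using this
  have hσ : σ = σ' := by
    ext1 i
    have := congrArg (fun d : G.Dart => d.snd) (congrFun h i)
    simpa only [bicliqueDarts, Subtype.coe_inj, EmbeddingLike.apply_eq_iff_eq] using this
  have hτ : τ = τ' := by
    ext1 i
    simpa using happ (Fin.castAdd k i)
  have hg : g = g' := by
    ext1 i
    simpa using happ (Fin.natAdd s i)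
  rw [hσ, hτ, hg]

theorem card_bicliqueCopy_mul_le {V : Type*} [Finite V] (G : SimpleGraph V) (s k : ℕ) :
    Nat.card (BicliqueCopy G s (s + k)) * ((s + k).factorial * (s.factorial * s ^ k)) ≤
      (2 * G.edgeSet.ncard) ^ (s + k) := by
  classical
  have := Fintype.ofFinite V
  have hdart : Nat.card G.Dart = 2 * G.edgeSet.ncard := by
    rw [Nat.card_eq_fintype_card, G.dart_card_eq_twice_card_edges,
      ← SimpleGraph.coe_edgeFinset, Set.ncard_coe_finset]
  have := Nat.card_le_card_of_injective _ (bicliqueDarts_injective G s k)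
  simpa only [Nat.card_prod, Nat.card_fun, Nat.card_perm, Nat.card_fin, hdart] using this

theorem pow_self_le_exp_pow_mul_factorial (n : ℕ) :
    (n : ℝ) ^ n ≤ Real.exp 1 ^ n * n.factorial := by
  have h := Real.pow_div_factorial_le_exp (n : ℝ) n.cast_nonneg n
  rwa [div_le_iff₀ (by positivity), ← Real.exp_one_pow] at h

/-- Let `G` be a graph with `q ≥ 1` edges and let `t ≥ s + 2 ≥ 3`. The number of copies of
`K_{s,t}` in `G` — i.e. pairs `(S, T)` of disjoint vertex subsets with `|S| = s`, `|T| = t`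
and all pairs between `S` and `T` being edges — is at most `(8e²q/(st))^t`. -/
theorem stmt5 {V : Type*} [Fintype V] (G : SimpleGraph V) (s t q : ℕ)
    (hs : 1 ≤ s) (ht : s + 2 ≤ t) (hq : G.edgeSet.ncard = q) (hq1 : 1 ≤ q) :
    (({p : Finset V × Finset V | p.1.card = s ∧ p.2.card = t ∧ Disjoint p.1 p.2 ∧
        ∀ a ∈ p.1, ∀ b ∈ p.2, G.Adj a b}.ncard : ℝ)) ≤
      (8 * Real.exp 1 ^ 2 * (q : ℝ) / ((s : ℝ) * (t : ℝ))) ^ t := by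
  obtain ⟨k, rfl⟩ : ∃ k, t = s + k := ⟨t - s, by omega⟩
  have hcount := card_bicliqueCopy_mul_le G s k
  rw [hq] at hcount
  change (Nat.card (BicliqueCopy G s (s + k)) : ℝ) ≤ _
  generalize Nat.card (BicliqueCopy G s (s + k)) = N at hcount ⊢
  have hcount' : (N : ℝ) * ((s + k).factorial * (s.factorial * s ^ k)) ≤ (2 * q) ^ (s + k) := by
    exact_mod_cast hcount
  have hs0 : (0 : ℝ) < s := by exact_mod_cast hs
  have ht0 : (0 : ℝ) < (s + k : ℕ) := by exact_mod_cast (by omega : 0 < s + k)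
  have he : Real.exp 1 ^ s ≤ Real.exp 1 ^ (s + k) :=
    pow_le_pow_right₀ (Real.one_le_exp zero_le_one) (by omega)
  rw [div_pow, le_div_iff₀ (by positivity)]
  generalize hsk : s + k = t at *
  calc (N : ℝ) * (s * t) ^ t = N * (t ^ t * (s ^ s * s ^ k)) := by
        rw [← pow_add, hsk, mul_pow]; ring
    _ ≤ N * ((Real.exp 1 ^ t * t.factorial) * ((Real.exp 1 ^ t * s.factorial) * s ^ k)) := by
        gcongr
        · exact pow_self_le_exp_pow_mul_factorial t
        · exact (pow_self_le_exp_pow_mul_factorial s).trans (by gcongr)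
    _ = (Real.exp 1 ^ 2) ^ t * (N * (t.factorial * (s.factorial * s ^ k))) := by ring
    _ ≤ (Real.exp 1 ^ 2) ^ t * (2 * q) ^ t := by gcongr
    _ = (2 * Real.exp 1 ^ 2 * q) ^ t := by rw [← mul_pow]; ring
    _ ≤ (8 * Real.exp 1 ^ 2 * q) ^ t := by gcongr; norm_num
end

section
/- Let m and x be positive integers with x ≥ 2m, and let x₁, …, x_m be non-negative integers with x₁ + ⋯ + x_m = x. Then ∑_{k=1}^{m} 2^{−k} (x_k² − x_k) ≥ x² / 2^{m+5}. -/
open Finset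

/-- For a natural number `n`, the square of the truncated predecessor is at most `n² - n`. -/
lemma sq_natCast_pred_le (n : ℕ) : ((n - 1 : ℕ) : ℝ) ^ 2 ≤ (n : ℝ) ^ 2 - n := by
  cases n with
  | zero => simp
  | succ n =>
    have h : (0 : ℝ) ≤ n := n.cast_nonneg
    push_cast [Nat.add_sub_cancel]
    nlinarith

lemma sum_two_pow_succ_le (m : ℕ) : ∑ k : Fin m, (2 : ℝ) ^ ((k : ℕ) + 1) ≤ 2 ^ (m + 1) := by
  rw [Fin.sum_univ_eq_sum_range (fun k => (2 : ℝ) ^ (k + 1)) m]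
  induction m with
  | zero => simp
  | succ m ih =>
    rw [Finset.sum_range_succ, pow_succ 2 (m + 1)]
    linarith

/-- Let `m` and `x` be positive integers with `x ≥ 2m`, and let `x₁, …, x_m` be non-negative
integers summing to `x`. Then `∑_{k=1}^m 2^{-k} (x_k² - x_k) ≥ x² / 2^{m+5}`. -/
theorem stmt6 (m x : ℕ) (hm : 1 ≤ m) (hx : 1 ≤ x) (hxm : 2 * m ≤ x)
    (f : Fin m → ℕ) (hsum : ∑ k, f k = x) :
    (x : ℝ) ^ 2 / 2 ^ (m + 5) ≤ ∑ k : Fin m, ((f k : ℝ) ^ 2 - (f k : ℝ)) / 2 ^ ((k : ℕ) + 1) := by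
  set S := ∑ k : Fin m, ((f k : ℝ) ^ 2 - (f k : ℝ)) / 2 ^ ((k : ℕ) + 1) with hS
  have hle : ∑ k : Fin m, ((f k - 1 : ℕ) : ℝ) ^ 2 / 2 ^ ((k : ℕ) + 1) ≤ S :=
    Finset.sum_le_sum fun k _ => by
      gcongr
      exact sq_natCast_pred_le (f k)
  have hS0 : 0 ≤ S := le_trans (Finset.sum_nonneg fun k _ => by positivity) hle
  have hlow : (x : ℝ) / 2 ≤ ∑ k : Fin m, ((f k - 1 : ℕ) : ℝ) := by
    have h : x ≤ ∑ k : Fin m, (f k - 1) + m := by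
      calc x = ∑ k, f k := hsum.symm
        _ ≤ ∑ k : Fin m, ((f k - 1) + 1) := Finset.sum_le_sum fun k _ => by omega
        _ = _ := by simp [Finset.sum_add_distrib]
    have h' : (x : ℝ) ≤ ∑ k : Fin m, ((f k - 1 : ℕ) : ℝ) + m := by exact_mod_cast h
    have hxm' : 2 * (m : ℝ) ≤ x := by exact_mod_cast hxm
    linarith
  have hcs : (∑ k : Fin m, ((f k - 1 : ℕ) : ℝ)) ^ 2 ≤
      (∑ k : Fin m, ((f k - 1 : ℕ) : ℝ) ^ 2 / 2 ^ ((k : ℕ) + 1)) *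
        ∑ k : Fin m, (2 : ℝ) ^ ((k : ℕ) + 1) :=
    Finset.sum_sq_le_sum_mul_sum_of_sq_le_mul _ (fun k _ => by positivity)
      (fun k _ => by positivity) (fun k _ => (div_mul_cancel₀ _ (by positivity)).ge)
  have hmain : ((x : ℝ) / 2) ^ 2 ≤ S * 2 ^ (m + 1) :=
    calc ((x : ℝ) / 2) ^ 2 ≤ (∑ k : Fin m, ((f k - 1 : ℕ) : ℝ)) ^ 2 := by gcongr
      _ ≤ _ := hcs
      _ ≤ S * 2 ^ (m + 1) :=
        mul_le_mul hle (sum_two_pow_succ_le m) (Finset.sum_nonneg fun k _ => by positivity) hS0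
  rw [div_le_iff₀ (by positivity)]
  have hpow : S * 2 ^ (m + 5) = 16 * (S * 2 ^ (m + 1)) := by ring
  have hnn : 0 ≤ S * 2 ^ (m + 1) := by positivity
  linarith
end
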